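/- Let P be an FLC, well-separated, expansive L-sub pattern on E with predecessor P', and let f : ℝ≥0 → ℝ≥0. Suppose property P_f holds: for all x ∈ E and R ≥ 0, if P[0, f(R)] = P[x, f(R)] then there exists g ∈ K_P with P'[0, R] = P'[L⁻¹x + L⁻¹g, R]. Then P satisfies unique composition modulo K_P: for all U, V ∈ Ω_P with σ(U) = σ(V) = P, there exists g ∈ K_P with LU = LV + g. -/

import Mathlib

open Metric Set Filter Topology Pointwise

variable {E : Type*} [NormedAddCommGroup E] [NormedSpace ℝ E] {S : Type*}

/-- Equality of the `U`-patches of the pattern `P` at `x` and of `Q` at `y`: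
`P[x,U] = Q[y,U]`. -/
def PatchEq (P Q : E → S) (x y : E) (U : Set E) : Prop :=
  ∀ u ∈ U, P (x + u) = Q (y + u)

/-- The translate `P + z` of a pattern `P`. -/
def transl (z : E) (P : E → S) : E → S := fun x => P (x - z)

/-- The distortion `L P` of a pattern `P` by a linear automorphism `L`. -/
def distort (L : E ≃ₗ[ℝ] E) (P : E → S) : E → S := fun x => P (L.symm x)

/-- `Q` is locally indistinguishable from `P` (`Q ≼ P`). -/
def LIfrom (Q P : E → S) : Prop :=
  ∀ U : Set E, IsCompact U → ∀ x : E, ∃ y : E, PatchEq Q P x y U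

/-- `P` and `Q` are locally isomorphic (`P ≈ Q`). -/
def LocIso (P Q : E → S) : Prop :=
  LIfrom P Q ∧ LIfrom Q P

/-- `Q` is locally derivable from `P` (`P ⊳ Q`). -/
def LD (P Q : E → S) : Prop :=
  ∃ c : ℝ, 0 ≤ c ∧ ∀ x y : E, PatchEq P P x y (closedBall 0 c) → Q x = Q y

/-- The group of translational periods of a pattern: `{g | P + g = P}`. -/
def periods (P : E → S) : AddSubgroup E where
  carrier := {g : E | ∀ x : E, P (x + g) = P x}
  zero_mem' := by intro x; rw [add_zero]
  add_mem' := by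
    intro a b ha hb
    simp only [Set.mem_setOf_eq] at ha hb ⊢
    intro x
    rw [← add_assoc, hb, ha]
  neg_mem' := by
    intro a ha
    simp only [Set.mem_setOf_eq] at ha ⊢
    intro x
    have h := ha (x + -a)
    have h2 : x + -a + a = x := by abel
    rw [h2] at h
    exact h.symm

/-- Finite local complexity (FLC) for a single pattern. -/
def IsFLC (P : E → S) : Prop :=
  ∀ U : Set E, IsCompact U → ∃ K : Set E, IsCompact K ∧ ∀ x : E, ∃ v ∈ K, PatchEq P P x v U

/-- Repetitivity for a single pattern. -/
def Repetitive (P : E → S) : Prop :=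
  ∀ U : Set E, IsCompact U →
    ∃ R : Set E, IsCompact R ∧ ∀ x y : E, ∃ v ∈ R, PatchEq P P x (y + v) U

/-- Well-separation for a single pattern. -/
def WellSeparated (P : E → S) : Prop :=
  ∃ V : Set E, IsCompact V ∧ ∀ x y : E, P x ≠ P y →
    ∃ B ∈ 𝓝 (0 : E), ∀ b ∈ B, ∀ b' ∈ B, ¬ PatchEq P P (x + b) (y + b') V

/-- Return discreteness for a single pattern. -/
def ReturnDiscrete (P : E → S) : Prop :=
  ∃ B ∈ 𝓝 (0 : E), ∃ V : Set E, IsCompact V ∧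
    ∀ x : E, ∀ b ∈ B, PatchEq P P x (x + b) V → b = 0

/-- The translational hull of a pattern: all patterns locally indistinguishable from it. -/
def patternHull (P : E → S) : Set (E → S) := {Q | LIfrom Q P}

/-- A pattern space: a nonempty set of patterns closed under being locally
indistinguishable from the collection. -/
def IsPatternSpace (Ω : Set (E → S)) : Prop :=
  Ω.Nonempty ∧ ∀ Q : E → S,
    (∀ U : Set E, IsCompact U → ∀ x : E, ∃ R ∈ Ω, ∃ y : E, PatchEq Q R x y U) → Q ∈ Ω

/-- Finite local complexity for a pattern space. -/
def IsFLCSpace (Ω : Set (E → S)) : Prop :=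
  ∀ U : Set E, IsCompact U → ∃ (n : ℕ) (Ps : Fin n → E → S) (Ks : Fin n → Set E),
    (∀ i, IsCompact (Ks i)) ∧ ∀ Q ∈ Ω, ∀ x : E, ∃ i, ∃ y ∈ Ks i, PatchEq Q (Ps i) x y U

/-- Well-separation for a pattern space. -/
def WellSeparatedSpace (Ω : Set (E → S)) : Prop :=
  ∃ V : Set E, IsCompact V ∧ ∀ P ∈ Ω, ∀ Q ∈ Ω, P 0 ≠ Q 0 →
    ∃ B ∈ 𝓝 (0 : E), ∀ b ∈ B, ∀ b' ∈ B, ¬ PatchEq P Q b b' V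

/-- Return discreteness for a pattern space. -/
def ReturnDiscreteSpace (Ω : Set (E → S)) : Prop :=
  ∃ B ∈ 𝓝 (0 : E), ∃ V : Set E, IsCompact V ∧
    ∀ P ∈ Ω, ∀ b ∈ B, PatchEq P P 0 b V → b = 0

/-- Repetitivity for a pattern space. -/
def RepetitiveSpace (Ω : Set (E → S)) : Prop :=
  ∀ U : Set E, IsCompact U → ∃ R : Set E, IsCompact R ∧
    ∀ P ∈ Ω, ∀ Q ∈ Ω, ∃ v ∈ R, PatchEq P Q 0 v U

/-- A local derivation (LD) map between two sets of patterns. -/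
def IsLDMapOn (f : (E → S) → (E → S)) (Ω Ω' : Set (E → S)) : Prop :=
  Set.MapsTo f Ω Ω' ∧ ∃ c : ℝ, 0 ≤ c ∧
    ∀ P ∈ Ω, ∀ Q ∈ Ω, ∀ x y : E, PatchEq P Q x y (closedBall 0 c) → f P x = f Q y

/-- An expansive linear automorphism (all eigenvalues of modulus strictly greater
than `1`; equivalently, iterates expand uniformly at an exponential rate). -/
def IsExpansive (L : E ≃ₗ[ℝ] E) : Prop :=
  ∃ C > (0 : ℝ), ∃ l > (1 : ℝ), ∀ (n : ℕ) (x : E), C * l ^ n * ‖x‖ ≤ ‖(L ^ n : E ≃ₗ[ℝ] E) x‖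

/-- `P` is `L`-sub with predecessor `P'`: `P' ≼ P` and `L P' ⊳ P`. -/
def IsLSub (L : E ≃ₗ[ℝ] E) (P P' : E → S) : Prop :=
  LIfrom P' P ∧ LD (distort L P') P

/-- An `L`-sub pattern space: `Ω` together with a surjective LD (subdivision) map
`S : L Ω → Ω`. -/
def IsLSubSpace (L : E ≃ₗ[ℝ] E) (Ω : Set (E → S)) (Sub : (E → S) → (E → S)) : Prop :=
  IsLDMapOn Sub (distort L '' Ω) Ω ∧ Set.SurjOn Sub (distort L '' Ω) Ω

/-- The substitution map `σ := S ∘ L`. -/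
def substMap (L : E ≃ₗ[ℝ] E) (Sub : (E → S) → (E → S)) : (E → S) → (E → S) :=
  fun Q => Sub (distort L Q)

theorem PatchEq.mono {P Q : E → S} {x y : E} {U W : Set E} (h : PatchEq P Q x y W)
    (hUW : U ⊆ W) : PatchEq P Q x y U := fun u hu => h u (hUW hu)

theorem PatchEq.symm {P Q : E → S} {x y : E} {U : Set E} (h : PatchEq P Q x y U) :
    PatchEq Q P y x U := fun u hu => (h u hu).symm

theorem PatchEq.trans {P Q R : E → S} {x y z : E} {U : Set E} (h : PatchEq P Q x y U)
    (h' : PatchEq Q R y z U) : PatchEq P R x z U := fun u hu => (h u hu).trans (h' u hu)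

theorem LIfrom.trans {P Q R : E → S} (h : LIfrom P Q) (h' : LIfrom Q R) : LIfrom P R := by
  intro U hU x
  obtain ⟨y, hy⟩ := h U hU x
  obtain ⟨z, hz⟩ := h' U hU y
  exact ⟨z, hy.trans hz⟩

theorem LIfrom.refl (P : E → S) : LIfrom P P := fun _ _ x => ⟨x, fun _ _ => rfl⟩

theorem mem_periods {P : E → S} {g : E} : g ∈ periods P ↔ ∀ x, P (x + g) = P x := Iff.rfl

theorem LIfrom.periods_le {P Q : E → S} (h : LIfrom Q P) : periods P ≤ periods Q := by
  intro g hg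
  rw [mem_periods] at hg ⊢
  intro x
  obtain ⟨y, hy⟩ := h {0, g} (Set.toFinite _).isCompact x
  have h0 := hy 0 (by simp)
  rw [add_zero, add_zero] at h0
  rw [hy g (by simp), h0, hg]

theorem LD.periods_le {P Q : E → S} (h : LD P Q) : periods P ≤ periods Q := by
  obtain ⟨c, -, hc⟩ := h
  intro g hg x
  refine hc _ _ fun u _ => ?_
  rw [add_right_comm]
  exact hg _

theorem map_mem_periods_distort (L : E ≃ₗ[ℝ] E) {P : E → S} {g : E} (hg : g ∈ periods P) :
    L g ∈ periods (distort L P) := by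
  intro x
  simp only [distort, map_add, LinearEquiv.symm_apply_apply]
  exact hg _

/-- `patchDescent L P P' n U` is the set of points whose `U`-patch in `P` arises by following
`n` times the correspondence sending `y` to the points of `P` that look like `P'` at `L⁻¹ y`. -/
def patchDescent (L : E ≃ₗ[ℝ] E) (P P' : E → S) : ℕ → Set E → Set E
  | 0, _ => Set.univ
  | n + 1, U => {x | ∃ y ∈ patchDescent L P P' n (L '' U), PatchEq P' P (L.symm y) x U}

section patchDescent

variable {L : E ≃ₗ[ℝ] E} {P P' : E → S}

theorem patchDescent_mono (n : ℕ) {U W : Set E} (h : U ⊆ W) :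
    patchDescent L P P' n W ⊆ patchDescent L P P' n U := by
  induction n generalizing U W with
  | zero => exact subset_rfl
  | succ n ih =>
    rintro x ⟨y, hy, hxy⟩
    exact ⟨y, ih (Set.image_mono h) hy, hxy.mono h⟩

theorem patchDescent_succ_subset (n : ℕ) (U : Set E) :
    patchDescent L P P' (n + 1) U ⊆ patchDescent L P P' n U := by
  induction n generalizing U with
  | zero => exact Set.subset_univ _
  | succ n ih =>
    rintro x ⟨y, hy, hxy⟩
    exact ⟨y, ih _ hy, hxy⟩

theorem PatchEq.mem_patchDescent {n : ℕ} {U : Set E} {x x' : E} (h : PatchEq P P x x' U)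
    (hx : x ∈ patchDescent L P P' n U) : x' ∈ patchDescent L P P' n U := by
  cases n with
  | zero => exact Set.mem_univ _
  | succ n =>
    obtain ⟨y, hy, hxy⟩ := hx
    exact ⟨y, hy, hxy.trans h⟩

theorem add_mem_patchDescent {n : ℕ} {U W : Set E} {x d : E} (hd : ∀ u ∈ W, d + u ∈ U)
    (hx : x ∈ patchDescent L P P' n U) : x + d ∈ patchDescent L P P' n W := by
  induction n generalizing U W x d with
  | zero => exact Set.mem_univ _
  | succ n ih =>
    obtain ⟨y, hy, hxy⟩ := hx
    refine ⟨y + L d, ih ?_ hy, fun u hu => ?_⟩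
    · rintro _ ⟨u, hu, rfl⟩
      exact ⟨d + u, hd u hu, map_add _ _ _⟩
    · have := hxy (d + u) (hd u hu)
      rwa [map_add, LinearEquiv.symm_apply_apply, add_assoc, add_assoc]

/-- For an FLC pattern, the sets `patchDescent` stop shrinking up to a bounded loss of radius. -/
theorem exists_patchDescent_subset_succ (hFLC : IsFLC P) {U W : Set E} (hW : IsCompact W)
    (hUW : ∀ u ∈ U, ∀ d : E, ‖d‖ ≤ 2 → d + u ∈ W) :
    ∃ n, patchDescent L P P' n W ⊆ patchDescent L P P' (n + 1) U := by
  obtain ⟨K, hK, hKW⟩ := hFLC W hW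
  obtain ⟨t, -, htfin, ht⟩ := hK.totallyBounded.exists_subset (Metric.dist_mem_uniformity one_pos)
  let T : ℕ → Set t := fun n => {v | ∃ b : E, ‖b‖ ≤ 1 ∧ (v : E) + b ∈ patchDescent L P P' n W}
  have hT : Antitone T := antitone_nat_of_succ_le fun n v ⟨b, hb, hv⟩ =>
    ⟨b, hb, patchDescent_succ_subset n W hv⟩
  have : Finite t := htfin
  obtain ⟨n, hn⟩ := WellFoundedLT.antitone_chain_condition hT
  have hTn : T n = T (n + 1) := hn (n + 1) n.le_succ
  refine ⟨n, fun x hx => ?_⟩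
  obtain ⟨v', hv'K, hxv'⟩ := hKW x
  obtain ⟨v, hv, hvv'⟩ := Set.mem_iUnion₂.1 (ht hv'K)
  have hb : ‖v' - v‖ ≤ 1 := by
    rw [← dist_eq_norm]
    exact le_of_lt hvv'
  have hmem : (⟨v, hv⟩ : t) ∈ T n :=
    ⟨v' - v, hb, by rw [add_sub_cancel]; exact hxv'.mem_patchDescent hx⟩
  rw [hTn] at hmem
  obtain ⟨b', hb', hvb'⟩ := hmem
  have h2 : ∀ u ∈ U, (v' - v - b') + u ∈ W := fun u hu =>
    hUW u hu _ ((norm_sub_le _ _).trans (by linarith))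
  have h3 := add_mem_patchDescent h2 hvb'
  have h4 : v + b' + (v' - v - b') = v' := by abel
  rw [h4] at h3
  exact (hxv'.mono fun u hu => by simpa using hUW u hu 0 (by simp)).symm.mem_patchDescent h3

theorem patchDescent_subset_succ_of_succ (hPP' : LIfrom P' P) {c : ℝ}
    (hc : ∀ x y : E, PatchEq (distort L P') (distort L P') x y (closedBall 0 c) → P x = P y)
    (hc0 : 0 ≤ c) {V W : Set E} (hV : ∀ u ∈ V, ∀ b ∈ closedBall (0 : E) c, L.symm (u + b) ∈ V)
    (hW : IsCompact W) (hVW : V ⊆ W) {m : ℕ}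
    (h : patchDescent L P P' (m + 1) W ⊆ patchDescent L P P' (m + 2) V) :
    patchDescent L P P' m (L '' W) ⊆ patchDescent L P P' (m + 1) V := by
  intro x hx
  obtain ⟨x', hx'⟩ := hPP' W hW (L.symm x)
  obtain ⟨y, hy, hyx'⟩ := h ⟨x, hx, hx'⟩
  have hyx : PatchEq P' P' (L.symm y) (L.symm x) V := hyx'.trans (hx'.mono hVW).symm
  have hyxP : PatchEq P P y x V := by
    intro u hu
    refine hc _ _ fun b hb => ?_
    simp only [distort]
    rw [add_assoc, add_assoc, map_add, map_add L.symm x]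
    exact hyx _ (hV u hu b hb)
  refine hyxP.mem_patchDescent (patchDescent_mono _ (fun u hu => ?_) hy)
  exact ⟨L.symm u, by simpa using hV u hu 0 (by simpa using hc0), by simp⟩

end patchDescent

theorem IsExpansive.exists_absorbing {L : E ≃ₗ[ℝ] E} (hL : IsExpansive L) (c r : ℝ) :
    ∃ (V : Set E) (M : ℝ), closedBall 0 r ⊆ V ∧ V ⊆ closedBall 0 M ∧
      ∀ u ∈ V, ∀ b ∈ closedBall (0 : E) c, L.symm (u + b) ∈ V := by
  obtain ⟨C, hC, l, hl, hexp⟩ := hL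
  have hinv : ∀ (n : ℕ) (x : E), C * l ^ n * ‖(L.symm ^ n : E ≃ₗ[ℝ] E) x‖ ≤ ‖x‖ := by
    intro n x
    have h := hexp n ((L.symm ^ n : E ≃ₗ[ℝ] E) x)
    have h1 : (L ^ n : E ≃ₗ[ℝ] E) ((L.symm ^ n : E ≃ₗ[ℝ] E) x) = x := by
      have h2 : (L ^ n : E ≃ₗ[ℝ] E) * L.symm ^ n = 1 := by
        change L ^ n * L⁻¹ ^ n = 1
        rw [inv_pow, mul_inv_cancel]
      rw [← LinearEquiv.mul_apply, h2]
      rfl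
    rwa [h1] at h
  set ρ := max r (c / (l - 1)) with hρ
  have hρc : ρ + c ≤ l * ρ := by
    have h := le_max_right r (c / (l - 1))
    rw [← hρ, div_le_iff₀ (by linarith)] at h
    linarith
  refine ⟨{u | ∀ n : ℕ, C * l ^ n * ‖(L.symm ^ n : E ≃ₗ[ℝ] E) u‖ ≤ ρ}, ρ / C, ?_, ?_, ?_⟩
  · intro u hu n
    exact (hinv n u).trans ((mem_closedBall_zero_iff.1 hu).trans (le_max_left _ _))
  · intro u hu
    have h := hu 0
    simp only [pow_zero, mul_one, LinearEquiv.coe_one, id] at h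
    rw [mem_closedBall_zero_iff, le_div_iff₀ hC]
    linarith
  · intro u hu b hb n
    have h1 : (L.symm ^ n : E ≃ₗ[ℝ] E) (L.symm (u + b))
        = (L.symm ^ (n + 1) : E ≃ₗ[ℝ] E) u + (L.symm ^ (n + 1) : E ≃ₗ[ℝ] E) b := by
      rw [← map_add, pow_succ]
      rfl
    have h2 := (hinv (n + 1) b).trans (mem_closedBall_zero_iff.1 hb)
    have h3 := hu (n + 1)
    rw [h1]
    have hl0 : 0 < l := by linarith
    refine le_of_mul_le_mul_left ?_ hl0
    calc l * (C * l ^ n * ‖(L.symm ^ (n + 1) : E ≃ₗ[ℝ] E) u + (L.symm ^ (n + 1) : E ≃ₗ[ℝ] E) b‖)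
        ≤ l * (C * l ^ n * (‖(L.symm ^ (n + 1) : E ≃ₗ[ℝ] E) u‖
            + ‖(L.symm ^ (n + 1) : E ≃ₗ[ℝ] E) b‖)) := by
          gcongr
          exact norm_add_le _ _
      _ = C * l ^ (n + 1) * ‖(L.symm ^ (n + 1) : E ≃ₗ[ℝ] E) u‖
            + C * l ^ (n + 1) * ‖(L.symm ^ (n + 1) : E ≃ₗ[ℝ] E) b‖ := by ring
      _ ≤ ρ + c := add_le_add h3 h2
      _ ≤ l * ρ := hρc

/-- An FLC expansive `L`-sub pattern is locally indistinguishable from its predecessor. -/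
theorem IsLSub.lifrom_predecessor [FiniteDimensional ℝ E] {L : E ≃ₗ[ℝ] E} (hL : IsExpansive L)
    {P P' : E → S} (hFLC : IsFLC P) (hsub : IsLSub L P P') : LIfrom P P' := by
  obtain ⟨hPP', c, hc0, hc⟩ := hsub
  intro U hU x
  obtain ⟨r, hr⟩ := hU.isBounded.subset_closedBall 0
  obtain ⟨V, M, hrV, hVM, hV⟩ := hL.exists_absorbing c r
  have : ProperSpace E := FiniteDimensional.proper ℝ E
  have hLc : Continuous L := LinearMap.continuous_of_finiteDimensional L.toLinearMap
  obtain ⟨n, hn⟩ := exists_patchDescent_subset_succ (L := L) (P' := P') hFLC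
    (isCompact_closedBall (0 : E) (M + 2)) (U := V) (fun u hu d hd => by
      have h1 := mem_closedBall_zero_iff.1 (hVM hu)
      rw [mem_closedBall_zero_iff]
      exact (norm_add_le _ _).trans (by linarith))
  have hdown : ∀ (n : ℕ) (W : Set E), IsCompact W → V ⊆ W →
      patchDescent L P P' n W ⊆ patchDescent L P P' (n + 1) V →
      ∃ W', patchDescent L P P' 0 W' ⊆ patchDescent L P P' 1 V := by
    intro n
    induction n with
    | zero => exact fun W _ _ h => ⟨W, h⟩
    | succ n ih =>
      intro W hW hVW h
      refine ih (L '' W) (hW.image hLc) (fun u hu => ?_)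
        (patchDescent_subset_succ_of_succ hPP' hc hc0 hV hW hVW h)
      exact ⟨L.symm u, hVW (by simpa using hV u hu 0 (by simpa using hc0)), by simp⟩
  obtain ⟨W', hW'⟩ := hdown n _ (isCompact_closedBall (0 : E) (M + 2))
    (hVM.trans (closedBall_subset_closedBall (by linarith))) hn
  obtain ⟨y, -, hy⟩ := hW' (Set.mem_univ x)
  exact ⟨L.symm y, (hy.mono (hr.trans hrV)).symm⟩

/-- A subgroup `G` with `L G ⊆ G` is contained in a bounded neighbourhood of `L G`. -/
theorem AddSubgroup.exists_norm_sub_map_le [FiniteDimensional ℝ E] (L : E ≃ₗ[ℝ] E)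
    (G : AddSubgroup E) (hG : ∀ g ∈ G, L g ∈ G) :
    ∃ M : ℝ, ∀ g ∈ G, ∃ h ∈ G, ‖g - L h‖ ≤ M := by
  obtain ⟨s, hsG, hspan, hli⟩ := exists_linearIndependent ℝ (G : Set E)
  have hfin : Finite s := hli.finite
  have := Fintype.ofFinite s
  have hLspan : Submodule.span ℝ (Set.range fun i : s => L (i : E)) =
      Submodule.span ℝ (G : Set E) := by
    have hrange : (Set.range fun i : s => L (i : E)) = L.toLinearMap '' s := by
      ext y
      simp
    rw [hrange, Submodule.span_image]
    apply Submodule.eq_of_le_of_finrank_eq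
    · rw [hspan, Submodule.map_span_le]
      exact fun g hg => Submodule.subset_span (hG g hg)
    · rw [← hspan]
      exact LinearEquiv.finrank_map_eq L _
  refine ⟨∑ i : s, ‖L (i : E)‖, fun g hg => ?_⟩
  have hg' : g ∈ Submodule.span ℝ (Set.range fun i : s => L (i : E)) := by
    rw [hLspan]
    exact Submodule.subset_span hg
  obtain ⟨a, rfl⟩ := (Submodule.mem_span_range_iff_exists_fun ℝ).1 hg'
  refine ⟨∑ i : s, ⌊a i⌋ • (i : E), G.sum_mem fun i _ => G.zsmul_mem (hsG i.2) _, ?_⟩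
  have h1 : ∑ i : s, a i • L (i : E) - L (∑ i : s, ⌊a i⌋ • (i : E))
      = ∑ i : s, Int.fract (a i) • L (i : E) := by
    rw [map_sum, ← Finset.sum_sub_distrib]
    refine Finset.sum_congr rfl fun i _ => ?_
    rw [map_zsmul, ← Int.cast_smul_eq_zsmul ℝ, ← sub_smul, Int.fract]
  rw [h1]
  refine (norm_sum_le _ _).trans (Finset.sum_le_sum fun i _ => ?_)
  rw [norm_smul, Real.norm_of_nonneg (Int.fract_nonneg _)]
  exact mul_le_of_le_one_left (norm_nonneg _) (Int.fract_lt_one _).le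

/-- In the hull of a well-separated pattern, agreement on growing balls up to convergent
translations passes to the limit. -/
theorem WellSeparated.eq_of_tendsto [FiniteDimensional ℝ E] {P Q Q' : E → S}
    (hP : WellSeparated P) (hQ : LIfrom Q P) (hQ' : LIfrom Q' P) {a : ℕ → E} {a₀ : E}
    (ha : Tendsto a atTop (𝓝 a₀)) {r : ℕ → ℝ} (hr : Tendsto r atTop atTop)
    (h : ∀ n, PatchEq Q Q' 0 (a n) (closedBall 0 (r n))) (u : E) : Q u = Q' (a₀ + u) := by
  by_contra hne
  obtain ⟨V, hV, hsep⟩ := hP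
  obtain ⟨ρ, hρ⟩ := hV.isBounded.subset_closedBall 0
  have : ProperSpace E := FiniteDimensional.proper ℝ E
  have hcpt := isCompact_closedBall (0 : E) (max ρ 0 + 1)
  obtain ⟨x, hx⟩ := hQ _ hcpt u
  obtain ⟨y, hy⟩ := hQ' _ hcpt (a₀ + u)
  have h0 : (0 : E) ∈ closedBall (0 : E) (max ρ 0 + 1) := by
    have := le_max_right ρ 0
    rw [mem_closedBall_zero_iff, norm_zero]
    linarith
  have hx0 := hx 0 h0
  have hy0 := hy 0 h0
  rw [add_zero, add_zero] at hx0 hy0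
  obtain ⟨B, hB, hBsep⟩ := hsep x y (by rwa [← hx0, ← hy0])
  have hdiff : Tendsto (fun n => a n - a₀) atTop (𝓝 0) := by
    simpa using ha.sub_const a₀
  have hev := (hdiff.eventually hB).and
    ((hdiff.eventually (closedBall_mem_nhds (0 : E) one_pos)).and
      (hr.eventually_ge_atTop (‖u‖ + ρ)))
  obtain ⟨n, hnB, hn1, hnr⟩ := hev.exists
  refine hBsep 0 (mem_of_mem_nhds hB) _ hnB fun v hv => ?_
  have hvρ := mem_closedBall_zero_iff.1 (hρ hv)
  have hn1' := mem_closedBall_zero_iff.1 hn1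
  have hmax := le_max_left ρ 0
  rw [add_zero, ← hx v (by rw [mem_closedBall_zero_iff]; linarith), add_assoc y,
    ← hy (a n - a₀ + v)
      (by rw [mem_closedBall_zero_iff]; exact (norm_add_le _ _).trans (by linarith))]
  have key := h n (u + v)
    (by rw [mem_closedBall_zero_iff]; exact (norm_add_le _ _).trans (by linarith))
  rw [zero_add] at key
  rw [key]
  congr 1
  abel

theorem WellSeparated.mem_periods_of_tendsto [FiniteDimensional ℝ E] {P : E → S}
    (hP : WellSeparated P) {a : ℕ → E} {a₀ : E} (ha : Tendsto a atTop (𝓝 a₀))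
    (h : ∀ n, a n ∈ periods P) : a₀ ∈ periods P := by
  intro x
  rw [add_comm]
  refine (hP.eq_of_tendsto (LIfrom.refl P) (LIfrom.refl P) ha tendsto_natCast_atTop_atTop
    (fun n u _ => ?_) x).symm
  rw [zero_add, add_comm]
  exact (h n u).symm

/-- Under property `P_f`, any preimage of `P` under substitution is a translate of the predecessor,
by an element of `L⁻¹ K_P`. -/
theorem exists_period_distort_eq_transl [FiniteDimensional ℝ E] {L : E ≃ₗ[ℝ] E}
    (hL : IsExpansive L) {P P' : E → S} (hFLC : IsFLC P) (hWS : WellSeparated P)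
    (hsub : IsLSub L P P') {f : ℝ → ℝ}
    (hPf : ∀ (x : E) (R : ℝ), 0 ≤ R → PatchEq P P 0 x (closedBall 0 (f R)) →
      ∃ g ∈ periods P, PatchEq P' P' 0 (L.symm x + L.symm g) (closedBall 0 R))
    {Sub : (E → S) → (E → S)}
    (hSubLD : IsLDMapOn Sub (distort L '' patternHull P) (patternHull P))
    (hSubP : Sub (distort L P') = P) {U : E → S} (hU : U ∈ patternHull P)
    (hUP : substMap L Sub U = P) :
    ∃ g ∈ periods P, distort L U = transl g (distort L P') := by
  have : ProperSpace E := FiniteDimensional.proper ℝ E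
  have hUP' : LIfrom U P' := LIfrom.trans hU (hsub.lifrom_predecessor hL hFLC)
  obtain ⟨-, c, -, hc⟩ := hSubLD
  have hPP' := hsub.1
  have hle : periods P ≤ periods P' := hPP'.periods_le
  obtain ⟨M, hM⟩ := AddSubgroup.exists_norm_sub_map_le L (periods P) fun g hg =>
    hsub.2.periods_le (map_mem_periods_distort L (hle hg))
  have hLc : Continuous L.symm := LinearMap.continuous_of_finiteDimensional L.symm.toLinearMap
  have hd : ∀ n : ℕ, ∃ d ∈ periods P, ‖d‖ ≤ M ∧
      PatchEq P' U 0 (L.symm d) (closedBall 0 (n : ℝ)) := by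
    intro n
    let W : Set E := L.symm '' closedBall 0 (f n + c) ∪
      (L.symm '' closedBall 0 M + closedBall 0 (n : ℝ))
    have hW : IsCompact W := ((isCompact_closedBall _ _).image hLc).union
      (((isCompact_closedBall _ _).image hLc).add (isCompact_closedBall _ _))
    obtain ⟨y, hy⟩ := hUP' W hW 0
    have hPy : PatchEq P P 0 (L y) (closedBall 0 (f n)) := by
      intro u hu
      have h1 := hc (distort L U) ⟨U, hU, rfl⟩ (distort L P') ⟨P', hPP', rfl⟩ (0 + u) (L y + u)
        (fun b hb => by
          have hub : u + b ∈ closedBall (0 : E) (f n + c) := by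
            rw [mem_closedBall_zero_iff] at *
            exact (norm_add_le _ _).trans (add_le_add hu hb)
          have := hy (L.symm (u + b)) (Or.inl ⟨_, hub, rfl⟩)
          simpa [distort, add_assoc] using this)
      rw [hSubP] at h1
      rw [← h1]
      exact congrFun hUP.symm _
    obtain ⟨g, hg, hgn⟩ := hPf _ _ n.cast_nonneg hPy
    obtain ⟨h, hh, hgh⟩ := hM g hg
    refine ⟨g - L h, sub_mem hg (hsub.2.periods_le (map_mem_periods_distort L (hle hh))), hgh,
      fun u hu => ?_⟩
    have hmem : L.symm (g - L h) + u ∈ W :=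
      Or.inr (Set.add_mem_add ⟨_, by rwa [mem_closedBall_zero_iff], rfl⟩ hu)
    have h2 := hy _ hmem
    rw [zero_add] at h2
    rw [hgn u hu, h2, ← hle hh (y + (L.symm (g - L h) + u))]
    congr 1
    simp only [map_sub, LinearEquiv.symm_apply_apply]
    abel
  choose d hdP hdM hdU using hd
  obtain ⟨d₀, -, φ, hφ, hlim⟩ := (isCompact_closedBall (0 : E) M).tendsto_subseq
    (x := d) fun n => by rw [mem_closedBall_zero_iff]; exact hdM n
  refine ⟨d₀, hWS.mem_periods_of_tendsto hlim fun n => hdP _, ?_⟩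
  have heq := hWS.eq_of_tendsto hPP' hU ((hLc.tendsto d₀).comp hlim)
    (tendsto_natCast_atTop_atTop.comp hφ.tendsto_atTop) fun n => hdU (φ n)
  funext z
  simp only [distort, transl]
  rw [heq, ← map_add, add_sub_cancel]

/-- Theorem: if an FLC, well-separated, expansive `L`-sub pattern satisfies property
`P_f`, then it satisfies unique composition modulo its group of periods. -/
theorem stmt9 [FiniteDimensional ℝ E] (L : E ≃ₗ[ℝ] E) (hL : IsExpansive L)
    (P P' : E → S) (hFLC : IsFLC P) (hWS : WellSeparated P) (hsub : IsLSub L P P')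
    (f : ℝ → ℝ)
    (hPf : ∀ (x : E) (R : ℝ), 0 ≤ R → PatchEq P P 0 x (closedBall 0 (f R)) →
      ∃ g ∈ periods P, PatchEq P' P' 0 (L.symm x + L.symm g) (closedBall 0 R))
    (Sub : (E → S) → (E → S))
    (hSubLD : IsLDMapOn Sub (distort L '' patternHull P) (patternHull P))
    (hSubP : Sub (distort L P') = P) :
    ∀ U ∈ patternHull P, ∀ V ∈ patternHull P,
      substMap L Sub U = P → substMap L Sub V = P →
      ∃ g ∈ periods P, distort L U = transl g (distort L V) := by
  intro U hU V hV hUP hVP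
  obtain ⟨g, hg, hgU⟩ :=
    exists_period_distort_eq_transl hL hFLC hWS hsub hPf hSubLD hSubP hU hUP
  obtain ⟨g', hg', hgV⟩ :=
    exists_period_distort_eq_transl hL hFLC hWS hsub hPf hSubLD hSubP hV hVP
  refine ⟨g - g', sub_mem hg hg', ?_⟩
  rw [hgU, hgV]
  funext z
  simp only [transl]
  congr 1
  abel
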